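/- Let ω ∈ ℝ², let s ≥ 0 be real, and let ψ : ℝ → [0,1] be smooth with ψ(x) = 1 for x ≥ 2 and ψ(x) = 0 for x ≤ 1/2. There exists a constant C = C(s, ψ, ω) such that for all finitely supported f̂, ĝ : ℤ² → ℂ, setting h(n) = ψ(ω·n)·Σ_{a∈ℤ², ω·a<0} f̂(a)·ĝ(n−a), one has (Σ_{n∈ℤ²} |ω·n|^{2s}|h(n)|²)^{1/2} ≤ C·(Σ_{a∈ℤ², ω·a<0} |f̂(a)|²)^{1/2}·sup_{x∈ℝ²} |Σ_{n∈ℤ²} |ω·n|^s ĝ(n)e^{2πi n·x}|. -/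

import Mathlib

open scoped Real

section
open MeasureTheory Complex Set
noncomputable section
namespace Para

/-- characters of the torus -/
def ch (n : ℤ × ℤ) (x : ℝ × ℝ) : ℂ :=
  Complex.exp (2 * Real.pi * Complex.I * (((n.1 : ℝ) * x.1 + (n.2 : ℝ) * x.2 : ℝ) : ℂ))

/-- Lebesgue measure on the unit square -/
def mu : Measure (ℝ × ℝ) :=
  (volume.restrict (Ioc (0 : ℝ) 1)).prod (volume.restrict (Ioc (0 : ℝ) 1))

instance : IsFiniteMeasure mu := by unfold mu; infer_instance

lemma ch_cont (n : ℤ × ℤ) : Continuous (ch n) := by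
  unfold ch; fun_prop

lemma ch_norm (n : ℤ × ℤ) (x : ℝ × ℝ) : ‖ch n x‖ = 1 := by
  unfold ch
  rw [Complex.norm_exp]
  simp

lemma ch_add (n m : ℤ × ℤ) (x : ℝ × ℝ) : ch (n + m) x = ch n x * ch m x := by
  unfold ch
  rw [← Complex.exp_add]
  congr 1
  push_cast [Prod.fst_add, Prod.snd_add]
  ring

lemma ch_conj_mul (n m : ℤ × ℤ) (x : ℝ × ℝ) :
    (starRingEnd ℂ) (ch n x) * ch m x = ch (m - n) x := by
  unfold ch
  rw [← Complex.exp_conj, ← Complex.exp_add]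
  congr 1
  simp only [map_mul, Complex.conj_I, Complex.conj_ofReal, map_ofNat]
  push_cast [Prod.fst_sub, Prod.snd_sub]
  ring

lemma int1 (k : ℤ) : ∫ x in Ioc (0 : ℝ) 1, Complex.exp (2 * Real.pi * Complex.I * k * x)
    = if k = 0 then 1 else 0 := by
  rw [← intervalIntegral.integral_of_le zero_le_one]
  split_ifs with h
  · simp [h]
  · rw [integral_exp_mul_complex]
    · have : Complex.exp (2 * Real.pi * Complex.I * k * (1 : ℝ)) = 1 := by
        rw [Complex.exp_eq_one_iff]
        exact ⟨k, by push_cast; ring⟩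
      rw [this]; simp
    · simp [h, Real.pi_ne_zero]

lemma int_ch (n : ℤ × ℤ) : ∫ x, ch n x ∂mu = if n = 0 then 1 else 0 := by
  have h : ∀ x : ℝ × ℝ, ch n x = Complex.exp (2 * Real.pi * Complex.I * n.1 * x.1) *
      Complex.exp (2 * Real.pi * Complex.I * n.2 * x.2) := by
    intro x
    unfold ch
    rw [← Complex.exp_add]
    congr 1
    push_cast
    ring
  simp_rw [h]
  unfold mu
  rw [integral_prod_mul (fun x : ℝ => Complex.exp (2 * Real.pi * Complex.I * n.1 * x))
    (fun x : ℝ => Complex.exp (2 * Real.pi * Complex.I * n.2 * x)), int1, int1]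
  rcases n with ⟨a, b⟩
  by_cases ha : a = 0 <;> by_cases hb : b = 0 <;> simp [ha, hb, Prod.ext_iff]

lemma mu_int {E : Type*} [NormedAddCommGroup E] {F : ℝ × ℝ → E} (hF : Continuous F) :
    Integrable F mu := by
  have h1 : mu = volume.restrict (Ioc (0 : ℝ) 1 ×ˢ Ioc (0 : ℝ) 1) := by
    unfold mu
    rw [Measure.prod_restrict]; rfl
  rw [h1]
  have : IntegrableOn F (Icc (0 : ℝ) 1 ×ˢ Icc (0 : ℝ) 1) volume :=
    hF.continuousOn.integrableOn_compact (isCompact_Icc.prod isCompact_Icc)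
  exact this.mono_set (Set.prod_mono Ioc_subset_Icc_self Ioc_subset_Icc_self)

/-- trigonometric sum -/
def tr {ι : Type*} (I : Finset ι) (k : ι → ℤ × ℤ) (p : ι → ℂ) (x : ℝ × ℝ) : ℂ :=
  ∑ i ∈ I, p i * ch (k i) x

lemma tr_cont {ι : Type*} (I : Finset ι) (k : ι → ℤ × ℤ) (p : ι → ℂ) :
    Continuous (tr I k p) := by
  unfold tr
  exact continuous_finsetSum _ fun i _ => continuous_const.mul (ch_cont _)

/-- bilinear form -/
def DD {ι : Type*} (I : Finset ι) (k : ι → ℤ × ℤ) (p q : ι → ℂ) : ℂ :=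
  ∑ i ∈ I, ∑ j ∈ I, if k i = k j then (starRingEnd ℂ) (p i) * q j else 0

lemma int_tr {ι : Type*} (I : Finset ι) (k : ι → ℤ × ℤ) (p q : ι → ℂ) :
    ∫ x, (starRingEnd ℂ) (tr I k p x) * tr I k q x ∂mu = DD I k p q := by
  have h : ∀ x, (starRingEnd ℂ) (tr I k p x) * tr I k q x =
      ∑ i ∈ I, ∑ j ∈ I, ((starRingEnd ℂ) (p i) * q j) * ch (k j - k i) x := by
    intro x
    unfold tr
    rw [map_sum, Finset.sum_mul_sum]
    refine Finset.sum_congr rfl fun i _ => Finset.sum_congr rfl fun j _ => ?_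
    rw [← ch_conj_mul, map_mul]; ring
  simp_rw [h]
  rw [integral_finsetSum]
  · unfold DD
    refine Finset.sum_congr rfl fun i _ => ?_
    rw [integral_finsetSum]
    · refine Finset.sum_congr rfl fun j _ => ?_
      rw [integral_const_mul, int_ch]
      by_cases hh : k i = k j
      · simp [hh]
      · have : k j - k i ≠ 0 := fun h => hh (sub_eq_zero.mp h).symm
        simp [hh, this]
    · intro j _
      exact (mu_int (ch_cont _)).const_mul _
  · intro i _
    exact integrable_finsetSum _ fun j _ => (mu_int (ch_cont _)).const_mul _

lemma int_normsq {ι : Type*} (I : Finset ι) (k : ι → ℤ × ℤ) (p : ι → ℂ) :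
    ∫ x, ‖tr I k p x‖ ^ 2 ∂mu = (DD I k p p).re := by
  rw [← int_tr]
  have h : ∀ x, (starRingEnd ℂ) (tr I k p x) * tr I k p x = ((‖tr I k p x‖ ^ 2 : ℝ) : ℂ) := by
    intro x
    rw [mul_comm, Complex.mul_conj']; push_cast; rfl
  simp_rw [h]
  rw [integral_complex_ofReal]; simp

lemma int_re {ι : Type*} (I : Finset ι) (k : ι → ℤ × ℤ) (p q : ι → ℂ) :
    ∫ x, ((starRingEnd ℂ) (tr I k p x) * tr I k q x).re ∂mu = (DD I k p q).re := by
  rw [← int_tr]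
  have := integral_re (𝕜 := ℂ) (f := fun x => (starRingEnd ℂ) (tr I k p x) * tr I k q x)
    (mu_int ((Complex.continuous_conj.comp (tr_cont I k p)).mul (tr_cont I k q)))
  simpa using this

/-- Bessel -/
lemma bessel {ι : Type*} (I : Finset ι) (k : ι → ℤ × ℤ) (p : ι → ℂ) (M : Finset (ℤ × ℤ)) :
    ∑ n ∈ M, ‖∑ i ∈ I, if k i = n then p i else 0‖ ^ 2 ≤ (DD I k p p).re := by
  classical
  have h1 : (DD I k p p).re = ∑ n ∈ M ∪ I.image k, ‖∑ i ∈ I, if k i = n then p i else 0‖ ^ 2 := by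
    have : DD I k p p = ∑ n ∈ M ∪ I.image k,
        ((‖∑ i ∈ I, if k i = n then p i else 0‖ ^ 2 : ℝ) : ℂ) := by
      have h2 : ∀ n, ((‖∑ i ∈ I, if k i = n then p i else 0‖ ^ 2 : ℝ) : ℂ) =
          ∑ i ∈ I, ∑ j ∈ I, if k i = n then
            (if k j = n then (starRingEnd ℂ) (p i) * p j else 0) else 0 := by
        intro n
        push_cast
        rw [← Complex.conj_mul', map_sum, Finset.sum_mul_sum]
        refine Finset.sum_congr rfl fun i _ => Finset.sum_congr rfl fun j _ => ?_
        split_ifs <;> simp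
      simp_rw [h2]
      rw [Finset.sum_comm]
      unfold DD
      refine Finset.sum_congr rfl fun i hi => ?_
      rw [Finset.sum_comm]
      refine Finset.sum_congr rfl fun j _ => ?_
      rw [Finset.sum_ite_eq (M ∪ I.image k)]
      have hm : k i ∈ M ∪ I.image k :=
        Finset.mem_union_right _ (Finset.mem_image_of_mem _ hi)
      rw [if_pos hm]
      simp only [eq_comm]
    rw [this, ← Complex.ofReal_sum, Complex.ofReal_re]
  rw [h1]
  exact Finset.sum_le_sum_of_subset_of_nonneg Finset.subset_union_left
    fun _ _ _ => by positivity

lemma DD_inj {ι : Type*} (I : Finset ι) (k : ι → ℤ × ℤ) (hk : Function.Injective k)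
    (p : ι → ℂ) : (DD I k p p).re = ∑ i ∈ I, ‖p i‖ ^ 2 := by
  classical
  unfold DD
  simp only [hk.eq_iff]
  rw [Complex.re_sum]
  refine Finset.sum_congr rfl fun i hi => ?_
  rw [Finset.sum_ite_eq, if_pos hi, Complex.conj_mul']
  norm_cast


lemma poisson_bound {ι : Type*} (T : Finset ι) (d : ι → ℂ) (ξ : ι → ℝ) (K : ℝ)
    (hK : ∀ τ : ℝ, ‖∑ n ∈ T, d n * Complex.exp (((ξ n * τ : ℝ) : ℂ) * I)‖ ≤ K)
    (t : ℝ) (ht : 0 ≤ t) :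
    ‖∑ n ∈ T, d n * ((Real.exp (-(|ξ n| * t)) : ℝ) : ℂ)‖ ≤ K := by
  set u : ℂ := ∑ n ∈ T, d n * ((Real.exp (-(|ξ n| * t)) : ℝ) : ℂ) with hu
  obtain ⟨c, hc, hcu⟩ : ∃ c : ℂ, ‖c‖ = 1 ∧ c * u = ‖u‖ := by
    obtain ⟨c, hc, h⟩ := RCLike.exists_norm_eq_mul_self u
    exact ⟨c, hc, by simpa using h.symm⟩
  let H : ℂ → ℂ := fun z => ∑ n ∈ T,
    if 0 ≤ ξ n then c * d n * Complex.exp (-(ξ n : ℂ) * z)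
      else (starRingEnd ℂ) (c * d n) * Complex.exp ((ξ n : ℂ) * z)
  have hHd : Differentiable ℂ H := by
    intro z
    apply DifferentiableAt.fun_sum
    intro n _
    split_ifs <;> fun_prop
  have hre : ∀ x y : ℝ, (H (x + y * I)).re =
      (c * ∑ n ∈ T, d n * (((Real.exp (-(|ξ n| * x)) : ℝ) : ℂ) *
        Complex.exp (((ξ n * (-y) : ℝ) : ℂ) * I))).re := by
    intro x y
    simp only [H]
    rw [Finset.mul_sum, Complex.re_sum, Complex.re_sum]
    refine Finset.sum_congr rfl fun n _ => ?_
    split_ifs with h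
    · rw [abs_of_nonneg h, Complex.ofReal_exp, ← Complex.exp_add, mul_assoc]
      congr 4
      push_cast; ring
    · push Not at h
      rw [← Complex.conj_re, map_mul, Complex.conj_conj, abs_of_neg h, Complex.ofReal_exp,
        ← Complex.exp_add, ← Complex.exp_conj, mul_assoc]
      congr 4
      simp only [map_add, map_mul, Complex.conj_ofReal, Complex.conj_I]
      push_cast; ring
  have hb : ∀ z : ℂ, 0 ≤ z.re → ‖H z‖ ≤ ∑ n ∈ T, ‖d n‖ := by
    intro z hz
    refine (norm_sum_le _ _).trans (Finset.sum_le_sum fun n _ => ?_)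
    split_ifs with h
    · rw [norm_mul, norm_mul, hc, one_mul, Complex.norm_exp]
      refine mul_le_of_le_one_right (norm_nonneg _) (Real.exp_le_one_iff.mpr ?_)
      simp; positivity
    · push Not at h
      rw [norm_mul, RCLike.norm_conj, norm_mul, hc, one_mul, Complex.norm_exp]
      refine mul_le_of_le_one_right (norm_nonneg _) (Real.exp_le_one_iff.mpr ?_)
      simp; exact mul_nonpos_of_nonpos_of_nonneg h.le hz
  have hE : ∀ z : ℂ, 0 ≤ z.re → ‖Complex.exp (H z)‖ ≤ Real.exp (∑ n ∈ T, ‖d n‖) := by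
    intro z hz
    rw [Complex.norm_exp]
    exact Real.exp_le_exp.mpr ((Complex.re_le_norm _).trans (hb z hz))
  have key : ‖Complex.exp (H (t : ℂ))‖ ≤ Real.exp K := by
    refine PhragmenLindelof.right_half_plane_of_bounded_on_real
      (f := fun z => Complex.exp (H z)) (C := Real.exp K) (z := (t : ℂ)) ?_ ?_ ?_ ?_ ?_
    · exact (Differentiable.cexp hHd).diffContOnCl
    · refine ⟨1, by norm_num, 0, ?_⟩
      refine Asymptotics.IsBigO.of_bound (Real.exp (∑ n ∈ T, ‖d n‖)) ?_
      refine Filter.Eventually.filter_mono inf_le_right ?_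
      rw [Filter.eventually_principal]
      intro z hz
      simpa using hE z (le_of_lt hz)
    · refine Filter.isBoundedUnder_of_eventually_le (a := Real.exp (∑ n ∈ T, ‖d n‖)) ?_
      filter_upwards [Filter.eventually_ge_atTop 0] with x hx
      exact hE x (by simpa using hx)
    · intro y
      rw [Complex.norm_exp]
      refine Real.exp_le_exp.mpr ?_
      have := hre 0 y
      simp only [Complex.ofReal_zero, zero_add] at this
      rw [this]
      refine (Complex.re_le_norm _).trans ?_
      rw [norm_mul, hc, one_mul]
      simpa using hK (-y)
    · simpa using ht
  rw [Complex.norm_exp, Real.exp_le_exp] at key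
  have h2 := hre t 0
  simp only [Complex.ofReal_zero, zero_mul, add_zero, neg_zero, mul_zero, Complex.exp_zero,
    mul_one] at h2
  rw [h2, ← hu, hcu, Complex.ofReal_re] at key
  exact key

/-- integrals of `t^(a-1) e^{-rt}` -/
lemma gam_int {a r : ℝ} (ha : 0 < a) (hr : 0 < r) :
    IntegrableOn (fun t : ℝ => t ^ (a - 1) * Real.exp (-(r * t))) (Ioi 0) := by
  have := integrableOn_rpow_mul_exp_neg_mul_rpow (p := 1) (s := a - 1) (b := r)
    (by linarith) one_pos hr
  simpa using this

lemma lin_int {r : ℝ} (hr : 0 < r) :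
    IntegrableOn (fun t : ℝ => t * Real.exp (-(r * t))) (Ioi 0) := by
  have := gam_int (a := 2) two_pos hr
  norm_num at this
  exact this

lemma lin_val {r : ℝ} (hr : 0 < r) :
    ∫ t in Ioi (0 : ℝ), t * Real.exp (-(r * t)) = 1 / r ^ 2 := by
  have := Real.integral_rpow_mul_exp_neg_mul_Ioi (a := 2) two_pos hr
  norm_num at this
  rw [this]; simp

lemma cs {α β : ℝ → ℝ} {ν : Measure ℝ} (hα : Integrable (fun t => α t ^ 2) ν)
    (hβ : Integrable (fun t => β t ^ 2) ν) (hab : Integrable (fun t => α t * β t) ν)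
    (hA : 0 < ∫ t, α t ^ 2 ∂ν) :
    (∫ t, α t * β t ∂ν) ^ 2 ≤ (∫ t, α t ^ 2 ∂ν) * ∫ t, β t ^ 2 ∂ν := by
  set A := ∫ t, α t ^ 2 ∂ν
  set θ := ∫ t, α t * β t ∂ν
  set B := ∫ t, β t ^ 2 ∂ν
  have h : 0 ≤ ∫ t, (θ * α t - A * β t) ^ 2 ∂ν := integral_nonneg fun t => sq_nonneg _
  have h2 : ∫ t, (θ * α t - A * β t) ^ 2 ∂ν = θ ^ 2 * A - 2 * θ * A * θ + A ^ 2 * B := by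
    have : ∀ t, (θ * α t - A * β t) ^ 2 =
        θ ^ 2 * α t ^ 2 - (2 * θ * A) * (α t * β t) + A ^ 2 * β t ^ 2 := fun t => by ring
    simp_rw [this]
    rw [integral_add (f := fun t => θ ^ 2 * α t ^ 2 - (2 * θ * A) * (α t * β t))
        ((hα.const_mul _).sub (hab.const_mul _)) (hβ.const_mul _),
      integral_sub (hα.const_mul _) (hab.const_mul _), integral_const_mul, integral_const_mul,
      integral_const_mul]
  rw [h2] at h
  have h3 : 0 ≤ A * (A * B - θ ^ 2) := by nlinarith
  have := nonneg_of_mul_nonneg_right h3 hA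
  linarith
/-- the linear form -/
def LL (ω : ℝ × ℝ) (n : ℤ × ℤ) : ℝ := ω.1 * (n.1 : ℝ) + ω.2 * (n.2 : ℝ)

lemma LL_add (ω : ℝ × ℝ) (n m : ℤ × ℤ) : LL ω (n + m) = LL ω n + LL ω m := by
  unfold LL; push_cast [Prod.fst_add, Prod.snd_add]; ring

/-- sum of indices -/
def kk (i : (ℤ × ℤ) × (ℤ × ℤ)) : ℤ × ℤ := i.1 + i.2

/-- decay rate -/
def lam (ω : ℝ × ℝ) (i : (ℤ × ℤ) × (ℤ × ℤ)) : ℝ := -LL ω i.1 + |LL ω i.2|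

/-- twice the positive part -/
def ww (ω : ℝ × ℝ) (n : ℤ × ℤ) : ℝ := |LL ω n| + LL ω n

lemma tr_prod (S T : Finset (ℤ × ℤ)) (u v : ℤ × ℤ → ℂ) (x : ℝ × ℝ) :
    tr (S ×ˢ T) kk (fun i => u i.1 * v i.2) x = tr S id u x * tr T id v x := by
  unfold tr kk
  rw [Finset.sum_mul_sum, Finset.sum_product]
  refine Finset.sum_congr rfl fun i _ => Finset.sum_congr rfl fun j _ => ?_
  simp only [ch_add, id]
  ring

/-- Poisson extension coefficients of `f` -/
def fF (ω : ℝ × ℝ) (f : ℤ × ℤ → ℂ) (t : ℝ) (a : ℤ × ℤ) : ℂ :=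
  f a * ((Real.exp (-(-LL ω a * t)) : ℝ) : ℂ)

/-- Poisson extension coefficients of `G` -/
def gG (ω : ℝ × ℝ) (G : ℤ × ℤ → ℂ) (t : ℝ) (n : ℤ × ℤ) : ℂ :=
  G n * ((Real.exp (-(|LL ω n| * t)) : ℝ) : ℂ)

lemma fF_gG (ω : ℝ × ℝ) (f G : ℤ × ℤ → ℂ) (t : ℝ) (i : (ℤ × ℤ) × (ℤ × ℤ)) :
    fF ω f t i.1 * gG ω G t i.2 = f i.1 * G i.2 * ((Real.exp (-(lam ω i * t)) : ℝ) : ℂ) := by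
  unfold fF gG lam
  have : Real.exp (-((-LL ω i.1 + |LL ω i.2|) * t)) =
    Real.exp (-(-LL ω i.1 * t)) * Real.exp (-(|LL ω i.2| * t)) := by
    rw [← Real.exp_add]; congr 1; ring
  rw [this]; push_cast; ring

/-- the second derivative -/
def VV (ω : ℝ × ℝ) (S T : Finset (ℤ × ℤ)) (f G : ℤ × ℤ → ℂ) (t : ℝ) : ℂ :=
  ∑ i ∈ S ×ˢ T, ∑ j ∈ S ×ˢ T, if kk i = kk j then
    (starRingEnd ℂ) (f i.1 * G i.2) * (f j.1 * G j.2) *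
      (((lam ω i + lam ω j) ^ 2 * Real.exp (-((lam ω i + lam ω j) * t)) : ℝ) : ℂ) else 0

/-- coefficients of `F * W` -/
def pw (ω : ℝ × ℝ) (f G : ℤ × ℤ → ℂ) (t : ℝ) (i : (ℤ × ℤ) × (ℤ × ℤ)) : ℂ :=
  fF ω f t i.1 * ((ww ω i.2 : ℂ) * gG ω G t i.2)

lemma alg {B1 B2 a1 a2 x1 x2 : ℝ} (hM : -B1 + x1 = -B2 + x2) (h1 : a1 ^ 2 = x1 ^ 2)
    (h2 : a2 ^ 2 = x2 ^ 2) :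
    ((B1 + a1) + (B2 + a2)) ^ 2 = (a1 + x1) * (a2 + x2) +
      (2 * B1 + a1 - x1) * (2 * B2 + a2 - x2) + 2 * (B2 * (a2 + x2)) + 2 * (B1 * (a1 + x1)) := by
  linear_combination ((-B1 + x1) - (-B2 + x2)) * hM + h1 + h2

lemma VV_eq (ω : ℝ × ℝ) (S T : Finset (ℤ × ℤ)) (f G : ℤ × ℤ → ℂ) (t : ℝ) :
    VV ω S T f G t = DD (S ×ˢ T) kk (pw ω f G t) (pw ω f G t) +
      DD (S ×ˢ T) kk
        (fun i => ((-2 * LL ω i.1 + |LL ω i.2| - LL ω i.2 : ℝ) : ℂ) *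
          (fF ω f t i.1 * gG ω G t i.2))
        (fun i => ((-2 * LL ω i.1 + |LL ω i.2| - LL ω i.2 : ℝ) : ℂ) *
          (fF ω f t i.1 * gG ω G t i.2)) +
      2 * DD (S ×ˢ T) kk (fun i => fF ω f t i.1 * gG ω G t i.2)
        (fun i => (((-LL ω i.1 : ℝ) : ℂ) * fF ω f t i.1) * ((ww ω i.2 : ℂ) * gG ω G t i.2)) +
      2 * DD (S ×ˢ T) kk
        (fun i => (((-LL ω i.1 : ℝ) : ℂ) * fF ω f t i.1) * ((ww ω i.2 : ℂ) * gG ω G t i.2))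
        (fun i => fF ω f t i.1 * gG ω G t i.2) := by
  unfold VV DD
  simp only [Finset.mul_sum, ← Finset.sum_add_distrib]
  refine Finset.sum_congr rfl fun i _ => Finset.sum_congr rfl fun j _ => ?_
  by_cases h : kk i = kk j
  · simp only [if_pos h]
    have hL : -(-LL ω i.1) + LL ω i.2 = -(-LL ω j.1) + LL ω j.2 := by
      have := congrArg (LL ω) h
      unfold kk at this
      rw [LL_add, LL_add] at this
      linarith
    have e := alg hL (sq_abs (LL ω i.2)) (sq_abs (LL ω j.2))
    have e2 : lam ω i + lam ω j = ((-LL ω i.1 + |LL ω i.2|) + (-LL ω j.1 + |LL ω j.2|)) := rfl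
    have e3 : Real.exp (-((lam ω i + lam ω j) * t)) =
        Real.exp (-(lam ω i * t)) * Real.exp (-(lam ω j * t)) := by
      rw [← Real.exp_add]; congr 1; ring
    have r1 : ∀ (i : (ℤ × ℤ) × (ℤ × ℤ)), pw ω f G t i =
        (ww ω i.2 : ℂ) * (fF ω f t i.1 * gG ω G t i.2) := fun i => by unfold pw; ring
    have r2 : ∀ (i : (ℤ × ℤ) × (ℤ × ℤ)),
        (((-LL ω i.1 : ℝ) : ℂ) * fF ω f t i.1) * ((ww ω i.2 : ℂ) * gG ω G t i.2) =
        (((-LL ω i.1 : ℝ) : ℂ) * (ww ω i.2 : ℂ)) * (fF ω f t i.1 * gG ω G t i.2) :=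
      fun i => by ring
    rw [e3, e2, e]
    simp only [r1, r2]
    simp only [fF_gG, map_mul, Complex.conj_ofReal, ww]
    push_cast
    ring
  · simp only [if_neg h]; simp

lemma DD_symm_re {ι : Type*} (I : Finset ι) (k : ι → ℤ × ℤ) (p q : ι → ℂ) :
    (DD I k q p).re = (DD I k p q).re := by
  rw [← int_re, ← int_re]
  congr 1
  ext x
  simp only [Complex.mul_re, Complex.conj_re, Complex.conj_im]
  ring

lemma tr_poisson (ω : ℝ × ℝ) (T : Finset (ℤ × ℤ)) (G : ℤ × ℤ → ℂ) (K : ℝ)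
    (hK : ∀ x, ‖tr T id G x‖ ≤ K) (t : ℝ) (ht : 0 ≤ t) (x : ℝ × ℝ) :
    ‖tr T id (gG ω G t) x‖ ≤ K := by
  have := poisson_bound T (fun n => G n * ch n x) (LL ω) K (fun τ => by
    have h := hK (x.1 + ω.1 * τ / (2 * Real.pi), x.2 + ω.2 * τ / (2 * Real.pi))
    convert h using 2
    unfold tr
    refine Finset.sum_congr rfl fun n _ => ?_
    unfold ch LL
    rw [mul_assoc (G n), ← Complex.exp_add]
    simp only [id]
    congr 2
    have : (Real.pi : ℂ) ≠ 0 := by simp [Real.pi_ne_zero]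
    push_cast
    field_simp
    ring) t ht
  convert this using 2
  unfold tr gG
  refine Finset.sum_congr rfl fun n _ => ?_
  simp only [id]; ring

lemma pointwise_ineq (ω : ℝ × ℝ) (S T : Finset (ℤ × ℤ)) (f G : ℤ × ℤ → ℂ) (K : ℝ)
    (hK : ∀ x, ‖tr T id G x‖ ≤ K) (t : ℝ) (ht : 0 ≤ t) :
    (1 / 2) * (DD (S ×ˢ T) kk (pw ω f G t) (pw ω f G t)).re ≤ (VV ω S T f G t).re +
      8 * K ^ 2 * ∑ a ∈ S, ‖f a‖ ^ 2 * (LL ω a) ^ 2 * Real.exp (-((-2 * LL ω a) * t)) := by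
  have hK0 : 0 ≤ K := (norm_nonneg _).trans (hK 0)
  have hY : ∑ a ∈ S, ‖f a‖ ^ 2 * (LL ω a) ^ 2 * Real.exp (-((-2 * LL ω a) * t)) =
      ∫ x, ‖tr S id (fun a => ((-LL ω a : ℝ) : ℂ) * fF ω f t a) x‖ ^ 2 ∂mu := by
    rw [int_normsq, DD_inj _ _ Function.injective_id]
    refine Finset.sum_congr rfl fun a _ => ?_
    unfold fF
    rw [norm_mul, norm_mul, Complex.norm_real, Complex.norm_real, mul_pow, mul_pow,
      Real.norm_eq_abs, Real.norm_eq_abs, sq_abs, sq_abs, ← Real.exp_nat_mul]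
    have : -(-2 * LL ω a * t) = ((2 : ℕ) : ℝ) * -(-LL ω a * t) := by push_cast; ring
    rw [this]; ring
  set F := tr S id (fF ω f t) with hF
  set F1 := tr S id (fun a => ((-LL ω a : ℝ) : ℂ) * fF ω f t a) with hF1
  set W := tr T id (fun n => (ww ω n : ℂ) * gG ω G t n) with hW
  set g := tr T id (gG ω G t) with hg
  have cF : Continuous F := tr_cont _ _ _
  have cF1 : Continuous F1 := tr_cont _ _ _
  have cW : Continuous W := tr_cont _ _ _
  have cg : Continuous g := tr_cont _ _ _
  have hU : (DD (S ×ˢ T) kk (pw ω f G t) (pw ω f G t)).re = ∫ x, ‖F x * W x‖ ^ 2 ∂mu := by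
    rw [← int_normsq]
    congr 1; ext x
    rw [hF, hW, ← tr_prod]; rfl
  have hX : (DD (S ×ˢ T) kk (fun i => fF ω f t i.1 * gG ω G t i.2)
        (fun i => (((-LL ω i.1 : ℝ) : ℂ) * fF ω f t i.1) *
          ((ww ω i.2 : ℂ) * gG ω G t i.2))).re =
      ∫ x, ((starRingEnd ℂ) (F x * g x) * (F1 x * W x)).re ∂mu := by
    rw [← int_re]
    congr 1; ext x
    rw [hF, hW, hF1, hg, ← tr_prod, ← tr_prod (u := fun a => ((-LL ω a : ℝ) : ℂ) * fF ω f t a)]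
  have hZ : 0 ≤ (DD (S ×ˢ T) kk
        (fun i => ((-2 * LL ω i.1 + |LL ω i.2| - LL ω i.2 : ℝ) : ℂ) *
          (fF ω f t i.1 * gG ω G t i.2))
        (fun i => ((-2 * LL ω i.1 + |LL ω i.2| - LL ω i.2 : ℝ) : ℂ) *
          (fF ω f t i.1 * gG ω G t i.2))).re := by
    rw [← int_normsq]
    exact integral_nonneg fun x => by positivity
  have hV : (VV ω S T f G t).re ≥ (∫ x, ‖F x * W x‖ ^ 2 ∂mu) +
      4 * ∫ x, ((starRingEnd ℂ) (F x * g x) * (F1 x * W x)).re ∂mu := by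
    rw [VV_eq, ← hU, ← hX]
    simp only [Complex.add_re, two_mul]
    rw [DD_symm_re (p := fun i : (ℤ × ℤ) × (ℤ × ℤ) => fF ω f t i.1 * gG ω G t i.2)]
    linarith
  have cc : Continuous fun x => ((starRingEnd ℂ) (F x * g x) * (F1 x * W x)).re :=
    Complex.continuous_re.comp
      ((Complex.continuous_conj.comp (cF.mul cg)).mul (cF1.mul cW))
  have hmain : ∫ x, (1 / 2 * ‖F x * W x‖ ^ 2 - 8 * K ^ 2 * ‖F1 x‖ ^ 2) ∂mu ≤
      ∫ x, (‖F x * W x‖ ^ 2 +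
        4 * ((starRingEnd ℂ) (F x * g x) * (F1 x * W x)).re) ∂mu := by
    refine integral_mono (mu_int (by fun_prop)) (mu_int (by fun_prop)) fun x => ?_
    have h1 : -(K * ‖F x * W x‖ * ‖F1 x‖) ≤
        ((starRingEnd ℂ) (F x * g x) * (F1 x * W x)).re := by
      refine le_trans ?_ (neg_le_of_abs_le (Complex.abs_re_le_norm _))
      rw [neg_le_neg_iff]
      simp only [norm_mul, RCLike.norm_conj]
      have := tr_poisson ω T G K hK t ht x
      calc ‖F x‖ * ‖g x‖ * (‖F1 x‖ * ‖W x‖) = ‖g x‖ * (‖F x‖ * ‖W x‖ * ‖F1 x‖) := by ring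
        _ ≤ K * (‖F x‖ * ‖W x‖ * ‖F1 x‖) := by gcongr
        _ = _ := by ring
    simp only
    nlinarith [sq_nonneg (‖F x * W x‖ - 4 * (K * ‖F1 x‖))]
  rw [integral_add (mu_int (by fun_prop)) (mu_int (by fun_prop)),
    integral_sub (mu_int (by fun_prop)) (mu_int (by fun_prop)), integral_const_mul,
    integral_const_mul, integral_const_mul] at hmain
  rw [hY, hU]
  linarith

lemma re_mul_real (z : ℂ) (r : ℝ) : (z * (r : ℂ)).re = z.re * r := by simp

lemma lam_pos (ω : ℝ × ℝ) {S T : Finset (ℤ × ℤ)} (hS : ∀ a ∈ S, LL ω a < 0)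
    {i : (ℤ × ℤ) × (ℤ × ℤ)} (hi : i ∈ S ×ˢ T) : 0 < lam ω i := by
  have := hS _ (Finset.mem_product.mp hi).1
  unfold lam
  have := abs_nonneg (LL ω i.2)
  linarith

/-- finite double exponential sums -/
lemma expsum (ω : ℝ × ℝ) {S T : Finset (ℤ × ℤ)} (hS : ∀ a ∈ S, LL ω a < 0)
    (C : (ℤ × ℤ) × (ℤ × ℤ) → (ℤ × ℤ) × (ℤ × ℤ) → ℝ) :
    IntegrableOn (fun t : ℝ => t * ∑ i ∈ S ×ˢ T, ∑ j ∈ S ×ˢ T,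
      C i j * Real.exp (-((lam ω i + lam ω j) * t))) (Ioi 0) ∧
    ∫ t in Ioi (0 : ℝ), t * ∑ i ∈ S ×ˢ T, ∑ j ∈ S ×ˢ T,
      C i j * Real.exp (-((lam ω i + lam ω j) * t)) =
      ∑ i ∈ S ×ˢ T, ∑ j ∈ S ×ˢ T, C i j * (1 / (lam ω i + lam ω j) ^ 2) := by
  have h : ∀ t : ℝ, t * ∑ i ∈ S ×ˢ T, ∑ j ∈ S ×ˢ T,
      C i j * Real.exp (-((lam ω i + lam ω j) * t)) = ∑ i ∈ S ×ˢ T, ∑ j ∈ S ×ˢ T,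
      C i j * (t * Real.exp (-((lam ω i + lam ω j) * t))) := by
    intro t
    simp only [Finset.mul_sum]
    refine Finset.sum_congr rfl fun i _ => Finset.sum_congr rfl fun j _ => by ring
  simp_rw [h]
  have hint : ∀ i ∈ S ×ˢ T, ∀ j ∈ S ×ˢ T, Integrable (fun t : ℝ =>
      C i j * (t * Real.exp (-((lam ω i + lam ω j) * t)))) (volume.restrict (Ioi 0)) :=
    fun i hi j hj => (lin_int (add_pos (lam_pos ω hS hi) (lam_pos ω hS hj))).const_mul _
  refine ⟨integrable_finsetSum _ fun i hi => integrable_finsetSum _ fun j hj => hint i hi j hj, ?_⟩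
  rw [integral_finsetSum _ fun i hi => integrable_finsetSum _ fun j hj => hint i hi j hj]
  refine Finset.sum_congr rfl fun i hi => ?_
  rw [integral_finsetSum _ fun j hj => hint i hi j hj]
  refine Finset.sum_congr rfl fun j hj => ?_
  rw [integral_const_mul, lin_val (add_pos (lam_pos ω hS hi) (lam_pos ω hS hj))]

lemma DDpw_form (ω : ℝ × ℝ) (S T : Finset (ℤ × ℤ)) (f G : ℤ × ℤ → ℂ) (t : ℝ) :
    (DD (S ×ˢ T) kk (pw ω f G t) (pw ω f G t)).re =
    ∑ i ∈ S ×ˢ T, ∑ j ∈ S ×ˢ T, (if kk i = kk j then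
      ((starRingEnd ℂ) (f i.1 * G i.2) * (f j.1 * G j.2)).re * (ww ω i.2 * ww ω j.2) else 0) *
        Real.exp (-((lam ω i + lam ω j) * t)) := by
  unfold DD
  simp only [Complex.re_sum]
  refine Finset.sum_congr rfl fun i _ => Finset.sum_congr rfl fun j _ => ?_
  split_ifs
  · rw [mul_assoc, ← re_mul_real]
    have r1 : ∀ (i : (ℤ × ℤ) × (ℤ × ℤ)), pw ω f G t i =
        (ww ω i.2 : ℂ) * (fF ω f t i.1 * gG ω G t i.2) := fun i => by unfold pw; ring
    have e3 : Real.exp (-((lam ω i + lam ω j) * t)) =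
        Real.exp (-(lam ω i * t)) * Real.exp (-(lam ω j * t)) := by
      rw [← Real.exp_add]; congr 1; ring
    rw [r1, r1, fF_gG, fF_gG, e3]
    congr 1
    simp only [map_mul, Complex.conj_ofReal]
    push_cast
    ring
  · simp

lemma VV_form (ω : ℝ × ℝ) (S T : Finset (ℤ × ℤ)) (f G : ℤ × ℤ → ℂ) (t : ℝ) :
    (VV ω S T f G t).re =
    ∑ i ∈ S ×ˢ T, ∑ j ∈ S ×ˢ T, (if kk i = kk j then
      ((starRingEnd ℂ) (f i.1 * G i.2) * (f j.1 * G j.2)).re * (lam ω i + lam ω j) ^ 2 else 0) *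
        Real.exp (-((lam ω i + lam ω j) * t)) := by
  unfold VV
  simp only [Complex.re_sum]
  refine Finset.sum_congr rfl fun i _ => Finset.sum_congr rfl fun j _ => ?_
  split_ifs
  · rw [re_mul_real]; ring
  · simp

/-- `L²` bound for products -/
lemma prod_bound (S T : Finset (ℤ × ℤ)) (f G : ℤ × ℤ → ℂ) (K : ℝ)
    (hK : ∀ x, ‖tr T id G x‖ ≤ K) :
    (DD (S ×ˢ T) kk (fun i => f i.1 * G i.2) (fun i => f i.1 * G i.2)).re ≤
      K ^ 2 * ∑ a ∈ S, ‖f a‖ ^ 2 := by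
  rw [← int_normsq, ← DD_inj S id Function.injective_id, ← int_normsq, ← integral_const_mul]
  have c1 := tr_cont S id f
  have c2 := tr_cont (S ×ˢ T) kk (fun i => f i.1 * G i.2)
  refine integral_mono (mu_int (by fun_prop)) (mu_int (by fun_prop)) fun x => ?_
  simp only
  rw [tr_prod, norm_mul, mul_pow, mul_comm]
  have := hK x
  gcongr

lemma carleson (ω : ℝ × ℝ) (S T : Finset (ℤ × ℤ)) (hS : ∀ a ∈ S, LL ω a < 0)
    (f G : ℤ × ℤ → ℂ) (K : ℝ) (hK : ∀ x, ‖tr T id G x‖ ≤ K) :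
    IntegrableOn (fun t : ℝ => t * (DD (S ×ˢ T) kk (pw ω f G t) (pw ω f G t)).re) (Ioi 0) ∧
    ∫ t in Ioi (0 : ℝ), t * (DD (S ×ˢ T) kk (pw ω f G t) (pw ω f G t)).re ≤
      6 * K ^ 2 * ∑ a ∈ S, ‖f a‖ ^ 2 := by
  have hU := (expsum ω (T := T) hS (fun i j => (if kk i = kk j then
      ((starRingEnd ℂ) (f i.1 * G i.2) * (f j.1 * G j.2)).re * (ww ω i.2 * ww ω j.2) else 0))).1
  simp_rw [← DDpw_form] at hU
  refine ⟨hU, ?_⟩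
  obtain ⟨hV, hV2⟩ := expsum ω (T := T) hS (fun i j => (if kk i = kk j then
      ((starRingEnd ℂ) (f i.1 * G i.2) * (f j.1 * G j.2)).re * (lam ω i + lam ω j) ^ 2 else 0))
  simp_rw [← VV_form] at hV hV2
  have hV3 : ∫ t in Ioi (0 : ℝ), t * (VV ω S T f G t).re ≤ K ^ 2 * ∑ a ∈ S, ‖f a‖ ^ 2 := by
    rw [hV2]
    refine le_trans (le_of_eq ?_) (prod_bound S T f G K hK)
    unfold DD
    simp only [Complex.re_sum]
    refine Finset.sum_congr rfl fun i hi => Finset.sum_congr rfl fun j hj => ?_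
    have := (add_pos (lam_pos ω hS hi) (lam_pos ω hS hj)).ne'
    split_ifs
    · field_simp
    · simp
  have hYi : ∀ a ∈ S, Integrable (fun t : ℝ => (‖f a‖ ^ 2 * (LL ω a) ^ 2) *
      (t * Real.exp (-((-2 * LL ω a) * t)))) (volume.restrict (Ioi 0)) := fun a ha =>
    (lin_int (by linarith [hS a ha])).const_mul _
  have hYe : ∀ t : ℝ,
      t * ∑ a ∈ S, ‖f a‖ ^ 2 * (LL ω a) ^ 2 * Real.exp (-((-2 * LL ω a) * t)) =
      ∑ a ∈ S, (‖f a‖ ^ 2 * (LL ω a) ^ 2) * (t * Real.exp (-((-2 * LL ω a) * t))) := by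
    intro t
    rw [Finset.mul_sum]
    exact Finset.sum_congr rfl fun a _ => by ring
  have hY : IntegrableOn (fun t : ℝ => t * ∑ a ∈ S, ‖f a‖ ^ 2 * (LL ω a) ^ 2 *
      Real.exp (-((-2 * LL ω a) * t))) (Ioi 0) := by
    simp_rw [hYe]
    exact integrable_finsetSum _ hYi
  have hY2 : ∫ t in Ioi (0 : ℝ), t * ∑ a ∈ S, ‖f a‖ ^ 2 * (LL ω a) ^ 2 *
      Real.exp (-((-2 * LL ω a) * t)) = (1 / 4) * ∑ a ∈ S, ‖f a‖ ^ 2 := by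
    simp_rw [hYe]
    rw [integral_finsetSum _ hYi, Finset.mul_sum]
    refine Finset.sum_congr rfl fun a ha => ?_
    have h0 := hS a ha
    rw [integral_const_mul, lin_val (by linarith)]
    have := h0.ne
    field_simp
    norm_num
  have hm : ∫ t in Ioi (0 : ℝ), (1 / 2) * (t * (DD (S ×ˢ T) kk (pw ω f G t) (pw ω f G t)).re) ≤
      ∫ t in Ioi (0 : ℝ), (t * (VV ω S T f G t).re + 8 * K ^ 2 *
        (t * ∑ a ∈ S, ‖f a‖ ^ 2 * (LL ω a) ^ 2 * Real.exp (-((-2 * LL ω a) * t)))) := by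
    refine setIntegral_mono_on (hU.const_mul _) (hV.add (hY.const_mul _)) measurableSet_Ioi
      fun t ht => ?_
    have ht0 : 0 ≤ t := le_of_lt ht
    have := mul_le_mul_of_nonneg_left (pointwise_ineq ω S T f G K hK t ht0) ht0
    linarith
  rw [integral_const_mul, integral_add hV (hY.const_mul _), integral_const_mul, hY2] at hm
  linarith

/-- coefficient of `F * W` at `n` -/
def un (ω : ℝ × ℝ) (S T : Finset (ℤ × ℤ)) (f G : ℤ × ℤ → ℂ) (n : ℤ × ℤ) (t : ℝ) : ℂ :=
  ∑ i ∈ S ×ˢ T, if kk i = n then pw ω f G t i else 0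

/-- weighted symbol -/
def GG (ω : ℝ × ℝ) (s : ℝ) (g : ℤ × ℤ → ℂ) (m : ℤ × ℤ) : ℂ :=
  ((|LL ω m| ^ s : ℝ) : ℂ) * g m

/-- coefficient of the paraproduct at `n` -/
def An (S T : Finset (ℤ × ℤ)) (f g : ℤ × ℤ → ℂ) (n : ℤ × ℤ) : ℂ :=
  ∑ i ∈ S ×ˢ T, if kk i = n then f i.1 * g i.2 else 0

lemma un_cont (ω : ℝ × ℝ) (S T : Finset (ℤ × ℤ)) (f G : ℤ × ℤ → ℂ) (n : ℤ × ℤ) :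
    Continuous (un ω S T f G n) := by
  unfold un
  refine continuous_finsetSum _ fun i _ => ?_
  split_ifs
  · unfold pw fF gG
    fun_prop
  · exact continuous_const

lemma un_int (ω : ℝ × ℝ) (S T : Finset (ℤ × ℤ)) (hS : ∀ a ∈ S, LL ω a < 0)
    (f G : ℤ × ℤ → ℂ) (n : ℤ × ℤ) :
    IntegrableOn (fun t : ℝ => t * ‖un ω S T f G n t‖ ^ 2) (Ioi 0) := by
  have hK : ∀ x, ‖tr T id G x‖ ≤ ∑ m ∈ T, ‖G m‖ := by
    intro x
    unfold tr
    refine (norm_sum_le _ _).trans (Finset.sum_le_sum fun m _ => ?_)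
    rw [norm_mul, ch_norm, mul_one]
  have h := (carleson ω S T hS f G _ hK).1
  have hc := un_cont ω S T f G n
  refine Integrable.mono' h (Continuous.aestronglyMeasurable (by fun_prop)) ?_
  refine (ae_restrict_iff' measurableSet_Ioi).mpr (Filter.Eventually.of_forall fun t ht => ?_)
  have ht0 : 0 ≤ t := le_of_lt ht
  rw [Real.norm_of_nonneg (by positivity)]
  refine mul_le_mul_of_nonneg_left ?_ ht0
  have := bessel (S ×ˢ T) kk (pw ω f G t) {n}
  simpa [un] using this

lemma un_repr (ω : ℝ × ℝ) (s : ℝ) (hs : 0 < s) (S T : Finset (ℤ × ℤ)) (hS : ∀ a ∈ S, LL ω a < 0)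
    (f g : ℤ × ℤ → ℂ) (n : ℤ × ℤ) (hn : 0 < LL ω n) :
    IntegrableOn (fun t : ℝ => ((t ^ s * (LL ω n ^ s * Real.exp (-(LL ω n * t))) : ℝ) : ℂ) *
      un ω S T f (GG ω s g) n t) (Ioi 0) ∧
    ∫ t in Ioi (0 : ℝ), ((t ^ s * (LL ω n ^ s * Real.exp (-(LL ω n * t))) : ℝ) : ℂ) *
      un ω S T f (GG ω s g) n t =
      ((Real.Gamma (s + 1) * (1 / 2) ^ s : ℝ) : ℂ) * (((LL ω n ^ s : ℝ) : ℂ) * An S T f g n) := by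
  have he : ∀ t : ℝ, ((t ^ s * (LL ω n ^ s * Real.exp (-(LL ω n * t))) : ℝ) : ℂ) *
      un ω S T f (GG ω s g) n t = ∑ i ∈ S ×ˢ T, (if kk i = n then
        (((LL ω n ^ s * (2 * LL ω i.2) : ℝ) : ℂ) * (f i.1 * GG ω s g i.2)) else 0) *
        ((t ^ ((s + 1) - 1) * Real.exp (-((2 * LL ω i.2) * t)) : ℝ) : ℂ) := by
    intro t
    unfold un
    rw [Finset.mul_sum]
    refine Finset.sum_congr rfl fun i hi => ?_
    split_ifs with h
    · have h1 := hS _ (Finset.mem_product.mp hi).1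
      have h2 : LL ω n = LL ω i.1 + LL ω i.2 := by rw [← h]; unfold kk; rw [LL_add]
      have h3 : 0 < LL ω i.2 := by linarith
      have r1 : pw ω f (GG ω s g) t i =
        (ww ω i.2 : ℂ) * (fF ω f t i.1 * gG ω (GG ω s g) t i.2) := by unfold pw; ring
      have r2 : ww ω i.2 = 2 * LL ω i.2 := by unfold ww; rw [abs_of_pos h3]; ring
      have r3 : Real.exp (-((2 * LL ω i.2) * t)) =
          Real.exp (-(LL ω n * t)) * Real.exp (-(lam ω i * t)) := by
        rw [← Real.exp_add]; congr 1; unfold lam; rw [abs_of_pos h3, h2]; ring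
      rw [r1, fF_gG, r2, r3, add_sub_cancel_right]
      push_cast
      ring
    · simp
  have hpos : ∀ i ∈ S ×ˢ T, kk i = n → 0 < LL ω i.2 := by
    intro i hi h
    have h1 := hS _ (Finset.mem_product.mp hi).1
    have h2 : LL ω n = LL ω i.1 + LL ω i.2 := by rw [← h]; unfold kk; rw [LL_add]
    linarith
  have hint : ∀ i ∈ S ×ˢ T, Integrable (fun t : ℝ => (if kk i = n then
        (((LL ω n ^ s * (2 * LL ω i.2) : ℝ) : ℂ) * (f i.1 * GG ω s g i.2)) else 0) *
        ((t ^ ((s + 1) - 1) * Real.exp (-((2 * LL ω i.2) * t)) : ℝ) : ℂ))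
        (volume.restrict (Ioi 0)) := by
    intro i hi
    by_cases h : kk i = n
    · have h3 := hpos i hi h
      exact (Integrable.ofReal (gam_int (by linarith) (by linarith))).const_mul _
    · simp [h]
  simp_rw [he]
  refine ⟨integrable_finsetSum _ hint, ?_⟩
  rw [integral_finsetSum _ hint]
  unfold An
  simp only [Finset.mul_sum]
  refine Finset.sum_congr rfl fun i hi => ?_
  rw [integral_const_mul, integral_complex_ofReal]
  split_ifs with h
  · have h3 := hpos i hi h
    rw [Real.integral_rpow_mul_exp_neg_mul_Ioi (by linarith) (by linarith)]
    unfold GG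
    have e : LL ω n ^ s * (2 * LL ω i.2) * |LL ω i.2| ^ s *
        ((1 / (2 * LL ω i.2)) ^ (s + 1) * Real.Gamma (s + 1)) =
        Real.Gamma (s + 1) * (1 / 2) ^ s * LL ω n ^ s := by
      rw [abs_of_pos h3, Real.rpow_add (by positivity), Real.rpow_one,
        Real.div_rpow (by positivity) (by positivity), Real.mul_rpow (by positivity) h3.le,
        Real.div_rpow (by positivity) (by positivity)]
      simp only [Real.one_rpow]
      have : LL ω i.2 ^ s ≠ 0 := (Real.rpow_pos_of_pos h3 s).ne'
      field_simp
    have e' := congrArg (fun r : ℝ => (r : ℂ)) e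
    simp only [Complex.ofReal_mul] at e' ⊢
    linear_combination (f i.1 * g i.2) * e'
  · simp

lemma single (ω : ℝ × ℝ) (s : ℝ) (hs : 0 < s) (S T : Finset (ℤ × ℤ)) (hS : ∀ a ∈ S, LL ω a < 0)
    (f g : ℤ × ℤ → ℂ) (n : ℤ × ℤ) (hn : 0 < LL ω n) :
    (Real.Gamma (s + 1) * (1 / 2) ^ s) ^ 2 * (LL ω n ^ s * ‖An S T f g n‖) ^ 2 ≤
      (Real.Gamma (2 * s) * (1 / 2) ^ (2 * s)) *
        ∫ t in Ioi (0 : ℝ), t * ‖un ω S T f (GG ω s g) n t‖ ^ 2 := by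
  obtain ⟨h1, h2⟩ := un_repr ω s hs S T hS f g n hn
  have hG : 0 < Real.Gamma (s + 1) := Real.Gamma_pos_of_pos (by linarith)
  have hG2 : 0 < Real.Gamma (2 * s) := Real.Gamma_pos_of_pos (by linarith)
  let α : ℝ → ℝ := fun t => t ^ (s - 1 / 2) * (LL ω n ^ s * Real.exp (-(LL ω n * t)))
  let β : ℝ → ℝ := fun t => t ^ ((1 : ℝ) / 2) * ‖un ω S T f (GG ω s g) n t‖
  have hα2 : EqOn (fun t => α t ^ 2) (fun t => LL ω n ^ (2 * s) *
      (t ^ (2 * s - 1) * Real.exp (-((2 * LL ω n) * t)))) (Ioi 0) := by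
    intro t ht
    have ht' : 0 < t := ht
    simp only [α]
    rw [mul_pow, mul_pow, ← Real.rpow_mul_natCast ht'.le, ← Real.rpow_mul_natCast hn.le,
      ← Real.exp_nat_mul]
    have a1 : (s - 1 / 2) * ((2 : ℕ) : ℝ) = 2 * s - 1 := by push_cast; ring
    have a2 : s * ((2 : ℕ) : ℝ) = 2 * s := by push_cast; ring
    have a3 : ((2 : ℕ) : ℝ) * -(LL ω n * t) = -((2 * LL ω n) * t) := by push_cast; ring
    rw [a1, a2, a3]; ring
  have hβ2 : EqOn (fun t => β t ^ 2) (fun t => t * ‖un ω S T f (GG ω s g) n t‖ ^ 2) (Ioi 0) := by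
    intro t ht
    have ht' : 0 < t := ht
    simp only [β]
    rw [mul_pow, ← Real.rpow_mul_natCast ht'.le]
    norm_num
  have hαβ : EqOn (fun t => α t * β t)
      (fun t => ‖((t ^ s * (LL ω n ^ s * Real.exp (-(LL ω n * t))) : ℝ) : ℂ) *
        un ω S T f (GG ω s g) n t‖) (Ioi 0) := by
    intro t ht
    have ht' : 0 < t := ht
    simp only [α, β]
    rw [norm_mul, Complex.norm_real, Real.norm_of_nonneg (by positivity)]
    have : t ^ s = t ^ (s - 1 / 2) * t ^ ((1 : ℝ) / 2) := by
      rw [← Real.rpow_add ht']; congr 1; ring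
    rw [this]; ring
  have iα : IntegrableOn (fun t => α t ^ 2) (Ioi 0) :=
    ((integrableOn_congr_fun hα2 measurableSet_Ioi).mpr
      ((gam_int (by linarith) (by linarith)).const_mul _))
  have iβ : IntegrableOn (fun t => β t ^ 2) (Ioi 0) :=
    ((integrableOn_congr_fun hβ2 measurableSet_Ioi).mpr (un_int ω S T hS f _ n))
  have iαβ : IntegrableOn (fun t => α t * β t) (Ioi 0) :=
    ((integrableOn_congr_fun hαβ measurableSet_Ioi).mpr h1.norm)
  have vα : ∫ t in Ioi (0 : ℝ), α t ^ 2 = Real.Gamma (2 * s) * (1 / 2) ^ (2 * s) := by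
    rw [setIntegral_congr_fun measurableSet_Ioi hα2, integral_const_mul,
      Real.integral_rpow_mul_exp_neg_mul_Ioi (by linarith) (by linarith),
      Real.div_rpow (by positivity) (by positivity), Real.mul_rpow (by positivity) hn.le,
      Real.div_rpow (by positivity) (by positivity)]
    simp only [Real.one_rpow]
    have : LL ω n ^ (2 * s) ≠ 0 := (Real.rpow_pos_of_pos hn _).ne'
    field_simp
  have vβ := setIntegral_congr_fun (μ := volume) measurableSet_Ioi hβ2
  have vαβ := setIntegral_congr_fun (μ := volume) measurableSet_Ioi hαβ
  have key := cs iα iβ iαβ (by rw [vα]; positivity)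
  rw [vα, vβ, vαβ] at key
  refine le_trans ?_ key
  have h3 := norm_integral_le_integral_norm (μ := volume.restrict (Ioi (0 : ℝ)))
    (fun t : ℝ => ((t ^ s * (LL ω n ^ s * Real.exp (-(LL ω n * t))) : ℝ) : ℂ) *
        un ω S T f (GG ω s g) n t)
  rw [h2, norm_mul, norm_mul, Complex.norm_real, Complex.norm_real,
    Real.norm_of_nonneg (by positivity), Real.norm_of_nonneg (by positivity)] at h3
  rw [← mul_pow]
  exact pow_le_pow_left₀ (by positivity) h3 2

lemma core (ω : ℝ × ℝ) (s : ℝ) (hs : 0 ≤ s) : ∃ C : ℝ, 0 ≤ C ∧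
    ∀ (S T : Finset (ℤ × ℤ)) (f g : ℤ × ℤ → ℂ) (K : ℝ), (∀ a ∈ S, LL ω a < 0) →
    (∀ x, ‖tr T id (GG ω s g) x‖ ≤ K) → ∀ M : Finset (ℤ × ℤ), (∀ n ∈ M, 0 < LL ω n) →
    ∑ n ∈ M, (LL ω n ^ s * ‖An S T f g n‖) ^ 2 ≤ C * (K ^ 2 * ∑ a ∈ S, ‖f a‖ ^ 2) := by
  rcases hs.eq_or_lt with rfl | hs
  · refine ⟨1, zero_le_one, fun S T f g K hS hK M hM => ?_⟩
    have h0 : GG ω 0 g = g := by ext m; simp [GG]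
    rw [h0] at hK
    rw [one_mul]
    refine le_trans ?_ (prod_bound S T f g K hK)
    refine le_trans (le_of_eq ?_) (bessel (S ×ˢ T) kk (fun i => f i.1 * g i.2) M)
    refine Finset.sum_congr rfl fun n _ => ?_
    simp [An]
  · have hG : 0 < Real.Gamma (s + 1) := Real.Gamma_pos_of_pos (by linarith)
    have hG2 : 0 < Real.Gamma (2 * s) := Real.Gamma_pos_of_pos (by linarith)
    set c1 := (Real.Gamma (s + 1) * (1 / 2) ^ s) ^ 2 with hc1
    set c2 := Real.Gamma (2 * s) * (1 / 2) ^ (2 * s) with hc2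
    have p1 : 0 < c1 := by positivity
    have p2 : 0 < c2 := by positivity
    refine ⟨c2 * 6 / c1, by positivity, fun S T f g K hS hK M hM => ?_⟩
    obtain ⟨h1, h2⟩ := carleson ω S T hS f (GG ω s g) K hK
    have h3 : c1 * ∑ n ∈ M, (LL ω n ^ s * ‖An S T f g n‖) ^ 2 ≤
        c2 * ∫ t in Ioi (0 : ℝ), ∑ n ∈ M, t * ‖un ω S T f (GG ω s g) n t‖ ^ 2 := by
      rw [integral_finsetSum _ fun n _ => un_int ω S T hS f _ n, Finset.mul_sum, Finset.mul_sum]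
      exact Finset.sum_le_sum fun n hn => single ω s hs S T hS f g n (hM n hn)
    have h4 : ∫ t in Ioi (0 : ℝ), ∑ n ∈ M, t * ‖un ω S T f (GG ω s g) n t‖ ^ 2 ≤
        6 * K ^ 2 * ∑ a ∈ S, ‖f a‖ ^ 2 := by
      refine le_trans (setIntegral_mono_on (integrable_finsetSum _ fun n _ =>
        un_int ω S T hS f _ n) h1 measurableSet_Ioi fun t ht => ?_) h2
      rw [← Finset.mul_sum]
      exact mul_le_mul_of_nonneg_left (bessel (S ×ˢ T) kk (pw ω f (GG ω s g) t) M) (le_of_lt ht)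
    have h5 := h3.trans (mul_le_mul_of_nonneg_left h4 p2.le)
    rw [div_mul_eq_mul_div, le_div_iff₀ p1]
    linarith

lemma An_eq (ω : ℝ × ℝ) (f g : ℤ × ℤ → ℂ) (hf : (Function.support f).Finite)
    (hg : (Function.support g).Finite) (n : ℤ × ℤ) :
    (∑' a : ℤ × ℤ, (if LL ω a < 0 then f a * g (n - a) else 0)) =
      An (hf.toFinset.filter fun a => LL ω a < 0) hg.toFinset f g n := by
  rw [tsum_eq_sum (s := hf.toFinset.filter fun a => LL ω a < 0)]
  · unfold An
    rw [Finset.sum_product]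
    refine Finset.sum_congr rfl fun a ha => ?_
    rw [if_pos (Finset.mem_filter.mp ha).2]
    have : ∀ b, (kk (a, b) = n) ↔ (b = n - a) := fun b => by
      unfold kk; simp only; rw [eq_sub_iff_add_eq, add_comm]
    simp only [this]
    rw [Finset.sum_ite_eq']
    split_ifs with h
    · rfl
    · simp only [Set.Finite.mem_toFinset, Function.mem_support, not_not] at h
      simp [h]
  · intro a ha
    split_ifs with h
    · have : f a = 0 := by
        by_contra hfa
        exact ha (Finset.mem_filter.mpr ⟨by simpa using hfa, h⟩)
      simp [this]
    · rfl

end Para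

end
end

/-- second paraproduct estimate, Lemma 5.10, on the Fourier side:
`‖|∂_x|^s P_{+hi}(P₋(f)g)‖_{L²(𝕋²)} ≲ ‖P₋f‖_{L²(𝕋²)} ‖|∂_x|^s g‖_{L^∞}`, where
`h(n) = ψ(ω·n)·Σ_{ω·a<0} f̂(a)ĝ(n−a)` are the coefficients of the paraproduct. -/
theorem stmt_14 (ω : ℝ × ℝ) (s : ℝ) (hs : 0 ≤ s)
    (ψ : ℝ → ℝ) (hψsmooth : ContDiff ℝ (⊤ : ℕ∞) ψ) (hψrange : ∀ x, ψ x ∈ Set.Icc (0 : ℝ) 1)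
    (hψ1 : ∀ x : ℝ, 2 ≤ x → ψ x = 1) (hψ0 : ∀ x : ℝ, x ≤ 1 / 2 → ψ x = 0) :
    ∃ C : ℝ, ∀ f g : ℤ × ℤ → ℂ,
      (Function.support f).Finite → (Function.support g).Finite →
      (∑' n : ℤ × ℤ, |ω.1 * (n.1 : ℝ) + ω.2 * (n.2 : ℝ)| ^ (2 * s) *
          ‖(ψ (ω.1 * (n.1 : ℝ) + ω.2 * (n.2 : ℝ)) : ℂ) *
            ∑' a : ℤ × ℤ,
              (if ω.1 * (a.1 : ℝ) + ω.2 * (a.2 : ℝ) < 0 then f a * g (n - a) else 0)‖ ^ 2)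
          ^ ((1 : ℝ) / 2) ≤
        C * (∑' a : ℤ × ℤ,
              (if ω.1 * (a.1 : ℝ) + ω.2 * (a.2 : ℝ) < 0 then ‖f a‖ ^ 2 else 0)) ^ ((1 : ℝ) / 2) *
          (⨆ x : ℝ × ℝ,
            ‖∑' n : ℤ × ℤ,
                ((|ω.1 * (n.1 : ℝ) + ω.2 * (n.2 : ℝ)| ^ s : ℝ) : ℂ) * g n *
                  Complex.exp (2 * Real.pi * Complex.I *
                    (((n.1 : ℝ) * x.1 + (n.2 : ℝ) * x.2 : ℝ) : ℂ))‖) := by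
  obtain ⟨C, hC, hcore⟩ := Para.core ω s hs
  refine ⟨C ^ ((1 : ℝ) / 2), fun f g hf hg => ?_⟩
  change (∑' n : ℤ × ℤ, |Para.LL ω n| ^ (2 * s) * ‖(ψ (Para.LL ω n) : ℂ) *
            ∑' a : ℤ × ℤ, (if Para.LL ω a < 0 then f a * g (n - a) else 0)‖ ^ 2)
          ^ ((1 : ℝ) / 2) ≤
        C ^ ((1 : ℝ) / 2) * (∑' a : ℤ × ℤ,
              (if Para.LL ω a < 0 then ‖f a‖ ^ 2 else 0)) ^ ((1 : ℝ) / 2) *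
          (⨆ x : ℝ × ℝ, ‖∑' n : ℤ × ℤ, Para.GG ω s g n * Para.ch n x‖)
  set S := hf.toFinset.filter fun a => Para.LL ω a < 0 with hSdef
  set T := hg.toFinset with hTdef
  have hS : ∀ a ∈ S, Para.LL ω a < 0 := fun a ha => (Finset.mem_filter.mp ha).2
  have hF : (∑' a : ℤ × ℤ, (if Para.LL ω a < 0 then ‖f a‖ ^ 2 else 0)) =
      ∑ a ∈ S, ‖f a‖ ^ 2 := by
    rw [tsum_eq_sum (s := S)]
    · exact Finset.sum_congr rfl fun a ha => if_pos (hS a ha)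
    · intro a ha
      split_ifs with h
      · have : f a = 0 := by
          by_contra hfa
          exact ha (Finset.mem_filter.mpr ⟨by simpa using hfa, h⟩)
        simp [this]
      · rfl
  have hG : ∀ x, (∑' n : ℤ × ℤ, Para.GG ω s g n * Para.ch n x) =
      Para.tr T id (Para.GG ω s g) x := by
    intro x
    rw [tsum_eq_sum (s := T)]
    · rfl
    · intro m hm
      have : g m = 0 := by
        by_contra h
        exact hm (by simpa [hTdef] using h)
      simp [Para.GG, this]
  simp only [hG, hF, Para.An_eq ω f g hf hg]
  set K := ⨆ x : ℝ × ℝ, ‖Para.tr T id (Para.GG ω s g) x‖ with hKdef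
  have hK : ∀ x, ‖Para.tr T id (Para.GG ω s g) x‖ ≤ K := by
    intro x
    refine le_ciSup (f := fun x => ‖Para.tr T id (Para.GG ω s g) x‖)
      ⟨∑ m ∈ T, ‖Para.GG ω s g m‖, ?_⟩ x
    rintro _ ⟨y, rfl⟩
    refine (norm_sum_le _ _).trans (Finset.sum_le_sum fun m _ => ?_)
    rw [norm_mul, Para.ch_norm, mul_one]
  have hK0 : 0 ≤ K := (norm_nonneg _).trans (hK 0)
  have hB : (∑' n : ℤ × ℤ, |Para.LL ω n| ^ (2 * s) * ‖(ψ (Para.LL ω n) : ℂ) *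
      Para.An S T f g n‖ ^ 2) ≤ C * (K ^ 2 * ∑ a ∈ S, ‖f a‖ ^ 2) := by
    refine Real.tsum_le_of_sum_le (fun n => by positivity) fun M => ?_
    refine le_trans ?_ (hcore S T f g K hS hK (M.filter fun n => 0 < Para.LL ω n)
      (fun n hn => (Finset.mem_filter.mp hn).2))
    rw [Finset.sum_filter]
    refine Finset.sum_le_sum fun n _ => ?_
    split_ifs with h
    · rw [abs_of_pos h, mul_pow, ← Real.rpow_mul_natCast h.le, norm_mul, Complex.norm_real,
        Real.norm_of_nonneg (hψrange _).1]
      have e : s * ((2 : ℕ) : ℝ) = 2 * s := by push_cast; ring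
      rw [e]
      have := mul_le_of_le_one_left (norm_nonneg (Para.An S T f g n))
        (hψrange (Para.LL ω n)).2
      have h0 := (hψrange (Para.LL ω n)).1
      gcongr
    · rw [hψ0 _ (by linarith)]
      simp
  have hfin : (C * (K ^ 2 * ∑ a ∈ S, ‖f a‖ ^ 2)) ^ ((1 : ℝ) / 2) =
      C ^ ((1 : ℝ) / 2) * (∑ a ∈ S, ‖f a‖ ^ 2) ^ ((1 : ℝ) / 2) * K := by
    have hn : 0 ≤ ∑ a ∈ S, ‖f a‖ ^ 2 := Finset.sum_nonneg fun _ _ => by positivity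
    rw [Real.mul_rpow hC (by positivity), Real.mul_rpow (by positivity) hn,
      ← Real.sqrt_eq_rpow (K ^ 2), Real.sqrt_sq hK0]
    ring
  rw [← hfin]
  exact Real.rpow_le_rpow (tsum_nonneg fun n => by positivity) hB (by norm_num)
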